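/- arXiv:2205.10736 — 2 statements merged into one kernel-verified Lean document; each statement's English description precedes it below -/
import Mathlib

section
/- Fix n and k with 1 ≤ k ≤ n, step size α ∈ ℝ, discount γ ∈ ℝ, reward r ∈ ℝ, and a next-feature vector φ' ∈ ℝⁿ whose first k coordinates are zero (φ'ᵢ = 0 for all i < k). Let θ ∈ ℝⁿ have equal values on its first k coordinates: θᵢ = c for all i < k. Define the sequence θ⁽⁰⁾ = θ and θ⁽ʲ⁺¹⁾ = θ⁽ʲ⁾ + α·(r + γ⟨θ⁽ʲ⁾, φ'⟩ − ⟨θ⁽ʲ⁾, eⱼ⟩)·eⱼ for j = 0,…,k−1, where eⱼ is the j-th standard basis vector of ℝⁿ. Then after all k updates, θ⁽ᵏ⁾ = θ + α·δ·(∑_{i<k} eᵢ), where δ = r + γ⟨θ, φ'⟩ − c. -/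
open Matrix

lemma sum_single_filter_apply {n : ℕ} (p : Fin n → Prop) [DecidablePred p] (m : Fin n) :
    (∑ i ∈ Finset.univ.filter p, (Pi.single i 1 : Fin n → ℝ)) m = if p m then 1 else 0 := by
  simp [Finset.sum_apply, Pi.single_apply]

/-- Applying `k` successive TD(0) semi-gradient updates, the `j`-th on the
one-hot feature vector `eⱼ` (with shared reward `r` and next feature `φ'` supported
outside the first `k` coordinates), to a weight vector `θ` that is constant equal to `c`
on its first `k` coordinates, yields `θ + α·δ·(∑_{i<k} eᵢ)` where
`δ = r + γ⟨θ, φ'⟩ − c`. -/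
theorem stmt_2 (n k : ℕ) (hk1 : 1 ≤ k) (hkn : k ≤ n)
    (α γ r c : ℝ) (φ' : Fin n → ℝ) (hφ' : ∀ i : Fin n, (i : ℕ) < k → φ' i = 0)
    (θ : Fin n → ℝ) (hθ : ∀ i : Fin n, (i : ℕ) < k → θ i = c)
    (θseq : ℕ → (Fin n → ℝ))
    (h0 : θseq 0 = θ)
    (hstep : ∀ j, (hj : j < k) →
      θseq (j + 1) = θseq j +
        (α * (r + γ * (θseq j ⬝ᵥ φ') -
          θseq j ⬝ᵥ (Pi.single (⟨j, lt_of_lt_of_le hj hkn⟩ : Fin n) 1 : Fin n → ℝ))) •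
        (Pi.single (⟨j, lt_of_lt_of_le hj hkn⟩ : Fin n) 1 : Fin n → ℝ)) :
    θseq k = θ + (α * (r + γ * (θ ⬝ᵥ φ') - c)) •
      ∑ i ∈ Finset.univ.filter (fun i : Fin n => (i : ℕ) < k), (Pi.single i 1 : Fin n → ℝ) := by
  suffices h : ∀ j ≤ k, θseq j = θ + (α * (r + γ * (θ ⬝ᵥ φ') - c)) •
      ∑ i ∈ Finset.univ.filter (fun i : Fin n => (i : ℕ) < j), (Pi.single i 1 : Fin n → ℝ) from
    h k le_rfl
  intro j
  induction j with
  | zero => simp [h0]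
  | succ j ih =>
    intro hj
    have hdot : (∑ i ∈ Finset.univ.filter (fun i : Fin n => (i : ℕ) < j),
        (Pi.single i 1 : Fin n → ℝ)) ⬝ᵥ φ' = 0 := by
      rw [sum_dotProduct]
      refine Finset.sum_eq_zero fun i hi => ?_
      rw [single_one_dotProduct]
      exact hφ' i ((Finset.mem_filter.mp hi).2.trans hj)
    have hcoord : θseq j ⟨j, Nat.lt_of_lt_of_le hj hkn⟩ = c := by
      rw [ih (Nat.le_of_succ_le hj), Pi.add_apply, Pi.smul_apply, sum_single_filter_apply,
        hθ ⟨j, _⟩ hj]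
      simp
    rw [hstep j hj, dotProduct_single_one, hcoord, ih (Nat.le_of_succ_le hj), add_dotProduct,
      smul_dotProduct, hdot, smul_zero, add_zero, add_assoc, ← smul_add]
    congr 2
    ext m
    rw [Pi.add_apply, sum_single_filter_apply, sum_single_filter_apply, Pi.single_apply]
    simp only [Fin.ext_iff]
    grind
end

section
/- Fix n and k with 1 ≤ k ≤ n, step size α ∈ ℝ, discount γ ∈ ℝ, reward r ∈ ℝ, and a next-feature vector φ' ∈ ℝⁿ with φ'ᵢ = 0 for all i < k. Let θ ∈ ℝⁿ satisfy θᵢ = c for all i < k. Define the k-hot feature vector φ̃ = ∑_{i<k} eᵢ and the modified reward r̃ = r + (k−1)·c. Then a single TD(0) semi-gradient update of θ on the synthetic transition (φ̃, r̃, φ') with step size α, namely θ + α·(r̃ + γ⟨θ, φ'⟩ − ⟨θ, φ̃⟩)·φ̃, equals the result of performing k successive TD(0) updates of θ with step size α on the k environment transitions (e₀, r, φ'), (e₁, r, φ'), …, (e_{k−1}, r, φ') applied in order. -/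
open Matrix

/-- The TD(0) semi-gradient update with step size `α` and discount `γ` of weights `θ`
on the transition tuple `(φ, r, φ')`: `θ ← θ + α·(r + γ⟨θ,φ'⟩ − ⟨θ,φ⟩)·φ`. -/
def tdUpdate {n : ℕ} (α γ : ℝ) (θ φ : Fin n → ℝ) (r : ℝ) (φ' : Fin n → ℝ) :
    Fin n → ℝ :=
  θ + (α * (r + γ * (θ ⬝ᵥ φ') - θ ⬝ᵥ φ)) • φ

/-- The `j`-th standard basis (one-hot) vector of `ℝⁿ`, indexed by a natural `j`. -/
def oneHot (n : ℕ) (j : ℕ) : Fin n → ℝ :=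
  fun i => if (i : ℕ) = j then 1 else 0

/-- The result of `j` successive TD(0) updates of `θ`, the `l`-th (for `l = 0, …, j−1`,
applied in order) on the environment transition `(e_l, r, φ')`. -/
def tdIter {n : ℕ} (α γ : ℝ) (r : ℝ) (φ' : Fin n → ℝ) (θ : Fin n → ℝ) :
    ℕ → (Fin n → ℝ)
  | 0 => θ
  | j + 1 => tdUpdate α γ (tdIter α γ r φ' θ j) (oneHot n j) r φ'

theorem dotProduct_oneHot {n : ℕ} (v : Fin n → ℝ) (i : Fin n) :
    v ⬝ᵥ oneHot n i = v i := by
  simp [dotProduct, oneHot, Fin.val_inj]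

theorem sum_oneHot_apply {n : ℕ} (j : ℕ) (i : Fin n) :
    (∑ l ∈ Finset.range j, oneHot n l) i = if (i : ℕ) < j then 1 else 0 := by
  simp [Finset.sum_apply, oneHot]

theorem sum_oneHot_dotProduct_eq_zero {n j k : ℕ} (hjk : j ≤ k) {v : Fin n → ℝ}
    (hv : ∀ i : Fin n, (i : ℕ) < k → v i = 0) :
    (∑ l ∈ Finset.range j, oneHot n l) ⬝ᵥ v = 0 := by
  refine Finset.sum_eq_zero fun i _ => ?_
  rw [sum_oneHot_apply]
  split_ifs with h
  · rw [hv i (h.trans_le hjk), mul_zero]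
  · rw [zero_mul]

/-- The first `j` updates do not interact: each one adds the same multiple of its one-hot
feature. -/
theorem tdIter_eq_add_smul_sum_oneHot {n k : ℕ} (hkn : k ≤ n) {α γ r c : ℝ} {φ' θ : Fin n → ℝ}
    (hφ' : ∀ i : Fin n, (i : ℕ) < k → φ' i = 0) (hθ : ∀ i : Fin n, (i : ℕ) < k → θ i = c)
    {j : ℕ} (hj : j ≤ k) :
    tdIter α γ r φ' θ j =
      θ + (α * (r + γ * (θ ⬝ᵥ φ') - c)) • ∑ l ∈ Finset.range j, oneHot n l := by
  induction j with
  | zero => simp [tdIter]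
  | succ j ih =>
    have hval : (θ + (α * (r + γ * (θ ⬝ᵥ φ') - c)) • ∑ l ∈ Finset.range j, oneHot n l) ⬝ᵥ
        oneHot n j = c := by
      rw [dotProduct_oneHot _ ⟨j, by omega⟩, Pi.add_apply, Pi.smul_apply, sum_oneHot_apply,
        hθ ⟨j, by omega⟩ (by simpa using hj)]
      simp
    rw [tdIter, ih (by omega), tdUpdate, hval, add_dotProduct, smul_dotProduct,
      sum_oneHot_dotProduct_eq_zero (by omega) hφ', smul_zero, add_zero,
      Finset.sum_range_succ, smul_add, add_assoc]

theorem dotProduct_sum_oneHot {n k : ℕ} (hkn : k ≤ n) {c : ℝ} {θ : Fin n → ℝ}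
    (hθ : ∀ i : Fin n, (i : ℕ) < k → θ i = c) :
    θ ⬝ᵥ ∑ l ∈ Finset.range k, oneHot n l = k * c := by
  rw [dotProduct_sum, Finset.sum_congr rfl (g := fun _ => c), Finset.sum_const,
    Finset.card_range, nsmul_eq_mul]
  intro l hl
  have hl' : l < k := Finset.mem_range.mp hl
  rw [dotProduct_oneHot θ ⟨l, by omega⟩, hθ ⟨l, by omega⟩ hl']

/-- One TD(0) update on the synthetic transition `(φ̃, r̃, φ')`, with the
`k`-hot feature `φ̃ = ∑_{i<k} eᵢ` and modified reward `r̃ = r + (k−1)·c`, equals the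
result of `k` successive TD(0) updates on the environment transitions
`(e₀, r, φ'), …, (e_{k−1}, r, φ')` applied in order. -/
theorem stmt_3 (n k : ℕ) (hk1 : 1 ≤ k) (hkn : k ≤ n)
    (α γ r c : ℝ) (φ' : Fin n → ℝ) (hφ' : ∀ i : Fin n, (i : ℕ) < k → φ' i = 0)
    (θ : Fin n → ℝ) (hθ : ∀ i : Fin n, (i : ℕ) < k → θ i = c) :
    tdUpdate α γ θ (∑ i ∈ Finset.range k, oneHot n i) (r + ((k : ℝ) - 1) * c) φ' =
      tdIter α γ r φ' θ k := by
  rw [tdIter_eq_add_smul_sum_oneHot hkn hφ' hθ le_rfl, tdUpdate, dotProduct_sum_oneHot hkn hθ]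
  congr 2
  ring
end
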